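/- arXiv:1908.07814 — 4 statements merged into one kernel-verified Lean document; each statement's English description precedes it below -/
import Mathlib

section
/- Let {(X_n, d_n)} be a sequence of finite nonempty metric spaces with |X_n| → ∞ as n → ∞. Then the following three conditions are equivalent: (a) lim_{R → ∞} sup{ |A|·|B| / |X_n|² : n ∈ ℕ, A, B ⊆ X_n, d_n(A,B) ≥ R } = 0 (the supremum of the empty set being 0); (b) for every α ∈ (0, 1/2] and every c ∈ (0,1) there exists R > 0 such that for every n ∈ ℕ and every A ⊆ X_n with α|X_n| ≤ |A| ≤ |X_n|/2, one has |∂_R A| > c|A|; (c) for every α ∈ (0, 1/2] there exist c ∈ (0,1) and R > 0 such that for every n ∈ ℕ and every A ⊆ X_n with α|X_n| ≤ |A| ≤ |X_n|/2, one has |∂_R A| > c|A|. -/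
noncomputable section

namespace QL4

/-- The outer `R`-boundary `∂_R A = {x ∈ Z \ A : d(x,A) ≤ R}` of a subset `A` of a finite
metric space `Z`. -/
def outB {Z : Type*} [MetricSpace Z] [Fintype Z] (A : Finset Z) (R : ℝ) : Finset Z :=
  letI := Classical.propDecidable
  Finset.univ.filter fun x => x ∉ A ∧ ∃ a ∈ A, dist x a ≤ R

end QL4

namespace QL4

theorem exists_mem_of_half_lt_card {Z : Type*} [Fintype Z] {A B : Finset Z}
    (hA : (Fintype.card Z : ℝ) / 2 < A.card)
    (hB : (Fintype.card Z : ℝ) / 2 < B.card) : ∃ x ∈ A, x ∈ B := by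
  classical
  by_contra! hdisj
  have hcard := Finset.card_le_univ (A ∪ B)
  rw [Finset.card_union_of_disjoint (Finset.disjoint_left.mpr hdisj)] at hcard
  have : (A.card : ℝ) + B.card ≤ Fintype.card Z := by exact_mod_cast hcard
  linarith

theorem card_mul_card_div_sq_le_one {Z : Type*} [Fintype Z] (A B : Finset Z) :
    (A.card : ℝ) * (B.card : ℝ) / (Fintype.card Z : ℝ) ^ 2 ≤ 1 := by
  have hA : (A.card : ℝ) ≤ Fintype.card Z := by exact_mod_cast A.card_le_univ
  have hB : (B.card : ℝ) ≤ Fintype.card Z := by exact_mod_cast B.card_le_univ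
  refine div_le_one_of_le₀ ?_ (by positivity)
  rw [sq]
  gcongr

section Boundary

variable {Z : Type*} [MetricSpace Z] [Fintype Z]

theorem mem_outB {A : Finset Z} {R : ℝ} {x : Z} :
    x ∈ outB A R ↔ x ∉ A ∧ ∃ a ∈ A, dist x a ≤ R := by
  simp [outB]

/-- A set whose large supersets all have `R`-boundary of relative size at least `c` grows
geometrically under taking `R`-neighbourhoods, until it exceeds half of the space. -/
theorem exists_neighborhood_card_large {α c R : ℝ} (hα : 0 < α) (hc : 0 < c)
    (h : ∀ A : Finset Z, α * (Fintype.card Z : ℝ) ≤ (A.card : ℝ) →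
      (A.card : ℝ) ≤ (Fintype.card Z : ℝ) / 2 → c * (A.card : ℝ) < ((outB A R).card : ℝ))
    (hR : 0 < R) (A : Finset Z) (hA : α * (Fintype.card Z : ℝ) ≤ (A.card : ℝ)) (k : ℕ) :
    ∃ A' : Finset Z, (∀ x ∈ A', ∃ a ∈ A, dist x a ≤ k * R) ∧
      ((Fintype.card Z : ℝ) / 2 < A'.card ∨
        (1 + c) ^ k * (α * (Fintype.card Z : ℝ)) ≤ A'.card) := by
  classical
  induction k with
  | zero => exact ⟨A, fun x hx => ⟨x, hx, by simp⟩, Or.inr (by simpa using hA)⟩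
  | succ k ih =>
    obtain ⟨B, hB, hcard⟩ := ih
    by_cases hlarge : (Fintype.card Z : ℝ) / 2 < B.card
    · refine ⟨B, fun x hx => ?_, Or.inl hlarge⟩
      obtain ⟨a, ha, hd⟩ := hB x hx
      exact ⟨a, ha, by push_cast; linarith⟩
    · have hpow := hcard.resolve_left hlarge
      have hαN : 0 ≤ α * (Fintype.card Z : ℝ) := by positivity
      have hge : α * (Fintype.card Z : ℝ) ≤ B.card :=
        (le_mul_of_one_le_left hαN (one_le_pow₀ (by linarith))).trans hpow
      have hbd := h B hge (not_lt.mp hlarge)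
      refine ⟨B ∪ outB B R, fun x hx => ?_, Or.inr ?_⟩
      · rcases Finset.mem_union.mp hx with hx | hx
        · obtain ⟨a, ha, hd⟩ := hB x hx
          exact ⟨a, ha, by push_cast; linarith⟩
        · obtain ⟨-, y, hy, hxy⟩ := mem_outB.mp hx
          obtain ⟨a, ha, hd⟩ := hB y hy
          exact ⟨a, ha, by push_cast; linarith [dist_triangle x y a]⟩
      · rw [Finset.card_union_of_disjoint
          (Finset.disjoint_left.mpr fun x hx hx' => (mem_outB.mp hx').1 hx)]
        push_cast
        calc (1 + c) ^ (k + 1) * (α * (Fintype.card Z : ℝ))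
            = (1 + c) * ((1 + c) ^ k * (α * (Fintype.card Z : ℝ))) := by ring
          _ ≤ (1 + c) * B.card := by gcongr
          _ ≤ B.card + (outB B R).card := by linarith

/-- A set of at most half the points with small `R`-boundary is far from a large set. -/
theorem exists_far_of_card_outB_le {α c R : ℝ} [Nonempty Z] (hc : c ∈ Set.Ioo (0 : ℝ) 1)
    {A : Finset Z} (hA : α * (Fintype.card Z : ℝ) ≤ (A.card : ℝ))
    (hA' : (A.card : ℝ) ≤ (Fintype.card Z : ℝ) / 2)
    (hbd : ((outB A R).card : ℝ) ≤ c * (A.card : ℝ)) :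
    ∃ B : Finset Z, (∀ a ∈ A, ∀ b ∈ B, R ≤ dist a b) ∧
      α * ((1 - c) / 2) ≤ (A.card : ℝ) * (B.card : ℝ) / (Fintype.card Z : ℝ) ^ 2 := by
  classical
  obtain ⟨hc0, hc1⟩ := hc
  have hN : (0 : ℝ) < Fintype.card Z := by exact_mod_cast Fintype.card_pos
  refine ⟨(A ∪ outB A R)ᶜ, fun a ha b hb => ?_, ?_⟩
  · simp only [Finset.mem_compl, Finset.mem_union, mem_outB, not_or, not_and, not_exists,
      not_le] at hb
    rw [dist_comm]
    exact (hb.2 hb.1 a ha).le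
  · have hcard : (Fintype.card Z : ℝ) ≤
        ((A ∪ outB A R)ᶜ.card : ℝ) + (A.card + (outB A R).card) := by
      have h₁ := Finset.card_compl_add_card (A ∪ outB A R)
      have h₂ := Finset.card_union_le A (outB A R)
      exact_mod_cast (by omega : Fintype.card Z ≤
        (A ∪ outB A R)ᶜ.card + (A.card + (outB A R).card))
    have hB : (1 - c) / 2 * (Fintype.card Z : ℝ) ≤ ((A ∪ outB A R)ᶜ.card : ℝ) := by
      nlinarith
    rw [le_div_iff₀ (by positivity)]
    calc α * ((1 - c) / 2) * (Fintype.card Z : ℝ) ^ 2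
        = (α * (Fintype.card Z : ℝ)) * ((1 - c) / 2 * (Fintype.card Z : ℝ)) := by ring
      _ ≤ A.card * ((A ∪ outB A R)ᶜ.card : ℝ) :=
        mul_le_mul hA hB (mul_nonneg (by linarith) hN.le) (by positivity)

/-- If all sets of proportion between `α` and `1/2` expand, any two sets of proportion at least
`α` are at distance at most `2 k R` once `(1 + c) ^ k` beats `1 / (2 α)`. -/
theorem exists_dist_le_of_expanding {α c R : ℝ} [Nonempty Z] (hα : 0 < α) (hc : 0 < c) (hR : 0 < R)
    (h : ∀ A : Finset Z, α * (Fintype.card Z : ℝ) ≤ (A.card : ℝ) →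
      (A.card : ℝ) ≤ (Fintype.card Z : ℝ) / 2 → c * (A.card : ℝ) < ((outB A R).card : ℝ))
    {k : ℕ} (hk : 1 / (2 * α) < (1 + c) ^ k) {A B : Finset Z}
    (hA : α * (Fintype.card Z : ℝ) ≤ (A.card : ℝ))
    (hB : α * (Fintype.card Z : ℝ) ≤ (B.card : ℝ)) :
    ∃ a ∈ A, ∃ b ∈ B, dist a b ≤ 2 * k * R := by
  have hN : (0 : ℝ) < Fintype.card Z := by exact_mod_cast Fintype.card_pos
  have hhalf : (Fintype.card Z : ℝ) / 2 < (1 + c) ^ k * (α * (Fintype.card Z : ℝ)) := by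
    rw [div_lt_iff₀ (by positivity)] at hk
    nlinarith
  obtain ⟨A', hA', hA'card⟩ := exists_neighborhood_card_large hα hc h hR A hA k
  obtain ⟨B', hB', hB'card⟩ := exists_neighborhood_card_large hα hc h hR B hB k
  obtain ⟨x, hxA, hxB⟩ := exists_mem_of_half_lt_card
    (hA'card.elim id hhalf.trans_le) (hB'card.elim id hhalf.trans_le)
  obtain ⟨a, ha, hxa⟩ := hA' x hxA
  obtain ⟨b, hb, hxb⟩ := hB' x hxB
  exact ⟨a, ha, b, hb, by linarith [dist_triangle_left a b x]⟩

end Boundary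

section Sequence

open Filter

variable {Xp : ℕ → Type*} [∀ n, MetricSpace (Xp n)] [∀ n, Fintype (Xp n)]

theorem tendsto_sSup_card_mul_card_iff :
    Tendsto (fun R : ℝ => sSup {t : ℝ | ∃ (n : ℕ) (A B : Finset (Xp n)),
        (∀ a ∈ A, ∀ b ∈ B, R ≤ dist a b) ∧
        t = (A.card : ℝ) * (B.card : ℝ) / (Fintype.card (Xp n) : ℝ) ^ 2}) atTop (nhds 0) ↔
      ∀ ε > 0, ∃ R₀ : ℝ, ∀ R ≥ R₀, ∀ (n : ℕ) (A B : Finset (Xp n)),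
        (∀ a ∈ A, ∀ b ∈ B, R ≤ dist a b) →
        (A.card : ℝ) * (B.card : ℝ) / (Fintype.card (Xp n) : ℝ) ^ 2 < ε := by
  have hle (R : ℝ) (n : ℕ) (A B : Finset (Xp n)) (hAB : ∀ a ∈ A, ∀ b ∈ B, R ≤ dist a b) :
      (A.card : ℝ) * (B.card : ℝ) / (Fintype.card (Xp n) : ℝ) ^ 2 ≤
        sSup {t : ℝ | ∃ (n : ℕ) (A B : Finset (Xp n)),
          (∀ a ∈ A, ∀ b ∈ B, R ≤ dist a b) ∧
          t = (A.card : ℝ) * (B.card : ℝ) / (Fintype.card (Xp n) : ℝ) ^ 2} := by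
    refine le_csSup ⟨1, ?_⟩ ⟨n, A, B, hAB, rfl⟩
    rintro t ⟨n, A, B, -, rfl⟩
    exact card_mul_card_div_sq_le_one A B
  rw [Metric.tendsto_atTop]
  constructor
  · intro h ε hε
    obtain ⟨R₀, hR₀⟩ := h ε hε
    refine ⟨R₀, fun R hR n A B hAB => (hle R n A B hAB).trans_lt ?_⟩
    have := hR₀ R hR
    rw [Real.dist_eq, sub_zero] at this
    exact (le_abs_self _).trans_lt this
  · intro h ε hε
    obtain ⟨R₀, hR₀⟩ := h (ε / 2) (half_pos hε)
    refine ⟨R₀, fun R hR => ?_⟩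
    rw [Real.dist_eq, sub_zero, abs_of_nonneg]
    · refine (Real.sSup_le ?_ (half_pos hε).le).trans_lt (half_lt_self hε)
      rintro t ⟨n, A, B, hAB, rfl⟩
      exact (hR₀ R hR n A B hAB).le
    · refine Real.sSup_nonneg ?_
      rintro t ⟨n, A, B, -, rfl⟩
      positivity

end Sequence

end QL4

open Filter QL4 in
/-- **Theorem 3.4.** For a sequence of finite nonempty metric spaces `Xp n`
with `|Xp n| → ∞`, the following are equivalent:
(a) `lim_{R→∞} sup { |A||B|/|Xp n|² : n, A, B ⊆ Xp n, d(A,B) ≥ R } = 0`;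
(b) for every `α ∈ (0,1/2]` and every `c ∈ (0,1)` there is `R > 0` such that every `A ⊆ Xp n`
with `α|Xp n| ≤ |A| ≤ |Xp n|/2` satisfies `|∂_R A| > c|A|`;
(c) for every `α ∈ (0,1/2]` there are `c ∈ (0,1)` and `R > 0` with the same property. -/
theorem asymptotic_expander_tfae (Xp : ℕ → Type*) [∀ n, MetricSpace (Xp n)]
    [∀ n, Fintype (Xp n)] [∀ n, Nonempty (Xp n)]
    (hgrow : Tendsto (fun n => Fintype.card (Xp n)) atTop atTop) :
    ((Tendsto (fun R : ℝ => sSup {t : ℝ | ∃ (n : ℕ) (A B : Finset (Xp n)),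
          (∀ a ∈ A, ∀ b ∈ B, R ≤ dist a b) ∧
          t = (A.card : ℝ) * (B.card : ℝ) / (Fintype.card (Xp n) : ℝ) ^ 2})
        atTop (nhds 0)) ↔
      (∀ α ∈ Set.Ioc (0 : ℝ) (1 / 2), ∀ c ∈ Set.Ioo (0 : ℝ) 1, ∃ R : ℝ, 0 < R ∧
        ∀ (n : ℕ) (A : Finset (Xp n)),
          α * (Fintype.card (Xp n) : ℝ) ≤ (A.card : ℝ) →
          (A.card : ℝ) ≤ (Fintype.card (Xp n) : ℝ) / 2 →
          c * (A.card : ℝ) < ((outB A R).card : ℝ))) ∧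
    ((Tendsto (fun R : ℝ => sSup {t : ℝ | ∃ (n : ℕ) (A B : Finset (Xp n)),
          (∀ a ∈ A, ∀ b ∈ B, R ≤ dist a b) ∧
          t = (A.card : ℝ) * (B.card : ℝ) / (Fintype.card (Xp n) : ℝ) ^ 2})
        atTop (nhds 0)) ↔
      (∀ α ∈ Set.Ioc (0 : ℝ) (1 / 2), ∃ c ∈ Set.Ioo (0 : ℝ) 1, ∃ R : ℝ, 0 < R ∧
        ∀ (n : ℕ) (A : Finset (Xp n)),
          α * (Fintype.card (Xp n) : ℝ) ≤ (A.card : ℝ) →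
          (A.card : ℝ) ≤ (Fintype.card (Xp n) : ℝ) / 2 →
          c * (A.card : ℝ) < ((outB A R).card : ℝ))) := by
  rw [tendsto_sSup_card_mul_card_iff]
  have hab : (∀ ε > 0, ∃ R₀ : ℝ, ∀ R ≥ R₀, ∀ (n : ℕ) (A B : Finset (Xp n)),
        (∀ a ∈ A, ∀ b ∈ B, R ≤ dist a b) →
        (A.card : ℝ) * (B.card : ℝ) / (Fintype.card (Xp n) : ℝ) ^ 2 < ε) →
      (∀ α ∈ Set.Ioc (0 : ℝ) (1 / 2), ∀ c ∈ Set.Ioo (0 : ℝ) 1, ∃ R : ℝ, 0 < R ∧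
        ∀ (n : ℕ) (A : Finset (Xp n)),
          α * (Fintype.card (Xp n) : ℝ) ≤ (A.card : ℝ) →
          (A.card : ℝ) ≤ (Fintype.card (Xp n) : ℝ) / 2 →
          c * (A.card : ℝ) < ((outB A R).card : ℝ)) := by
    intro h α hα c hc
    obtain ⟨R₀, hR₀⟩ := h (α * ((1 - c) / 2)) (mul_pos hα.1 (half_pos (sub_pos.mpr hc.2)))
    refine ⟨max R₀ 1, by positivity, fun n A hA hA' => ?_⟩
    by_contra! hbd
    obtain ⟨B, hAB, hB⟩ := exists_far_of_card_outB_le hc hA hA' hbd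
    exact (hR₀ _ (le_max_left _ _) n A B hAB).not_ge hB
  have hbc : (∀ α ∈ Set.Ioc (0 : ℝ) (1 / 2), ∀ c ∈ Set.Ioo (0 : ℝ) 1, ∃ R : ℝ, 0 < R ∧
        ∀ (n : ℕ) (A : Finset (Xp n)),
          α * (Fintype.card (Xp n) : ℝ) ≤ (A.card : ℝ) →
          (A.card : ℝ) ≤ (Fintype.card (Xp n) : ℝ) / 2 →
          c * (A.card : ℝ) < ((outB A R).card : ℝ)) →
      (∀ α ∈ Set.Ioc (0 : ℝ) (1 / 2), ∃ c ∈ Set.Ioo (0 : ℝ) 1, ∃ R : ℝ, 0 < R ∧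
        ∀ (n : ℕ) (A : Finset (Xp n)),
          α * (Fintype.card (Xp n) : ℝ) ≤ (A.card : ℝ) →
          (A.card : ℝ) ≤ (Fintype.card (Xp n) : ℝ) / 2 →
          c * (A.card : ℝ) < ((outB A R).card : ℝ)) := fun h α hα =>
    ⟨1 / 2, by norm_num, h α hα (1 / 2) (by norm_num)⟩
  have hca : (∀ α ∈ Set.Ioc (0 : ℝ) (1 / 2), ∃ c ∈ Set.Ioo (0 : ℝ) 1, ∃ R : ℝ, 0 < R ∧
        ∀ (n : ℕ) (A : Finset (Xp n)),
          α * (Fintype.card (Xp n) : ℝ) ≤ (A.card : ℝ) →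
          (A.card : ℝ) ≤ (Fintype.card (Xp n) : ℝ) / 2 →
          c * (A.card : ℝ) < ((outB A R).card : ℝ)) →
      (∀ ε > 0, ∃ R₀ : ℝ, ∀ R ≥ R₀, ∀ (n : ℕ) (A B : Finset (Xp n)),
        (∀ a ∈ A, ∀ b ∈ B, R ≤ dist a b) →
        (A.card : ℝ) * (B.card : ℝ) / (Fintype.card (Xp n) : ℝ) ^ 2 < ε) := by
    intro h ε hε
    have hα : 0 < min ε (1 / 2) := by positivity
    obtain ⟨c, hc, R, hR, hexp⟩ := h (min ε (1 / 2)) ⟨hα, min_le_right _ _⟩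
    obtain ⟨k, hk⟩ := pow_unbounded_of_one_lt (1 / (2 * min ε (1 / 2)))
      (lt_add_of_pos_right 1 hc.1)
    refine ⟨2 * k * R + 1, fun S hS n A B hAB => ?_⟩
    by_contra! hge
    have hN : (0 : ℝ) < Fintype.card (Xp n) := by exact_mod_cast Fintype.card_pos
    have hAN : (A.card : ℝ) ≤ Fintype.card (Xp n) := by exact_mod_cast A.card_le_univ
    have hBN : (B.card : ℝ) ≤ Fintype.card (Xp n) := by exact_mod_cast B.card_le_univ
    rw [le_div_iff₀ (by positivity), sq, ← mul_assoc] at hge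
    have hA : ε * (Fintype.card (Xp n) : ℝ) ≤ A.card := le_of_mul_le_mul_right
      (hge.trans (mul_le_mul_of_nonneg_left hBN (Nat.cast_nonneg _))) hN
    have hB : ε * (Fintype.card (Xp n) : ℝ) ≤ B.card := le_of_mul_le_mul_right
      (hge.trans ((mul_le_mul_of_nonneg_right hAN (Nat.cast_nonneg _)).trans_eq
        (mul_comm _ _))) hN
    have hmin : min ε (1 / 2) * (Fintype.card (Xp n) : ℝ) ≤ ε * Fintype.card (Xp n) :=
      mul_le_mul_of_nonneg_right (min_le_left _ _) hN.le
    obtain ⟨a, ha, b, hb, hd⟩ :=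
      exists_dist_le_of_expanding hα hc.1 hR (hexp n) hk (hmin.trans hA) (hmin.trans hB)
    linarith [hAB a ha b hb]
  exact ⟨⟨hab, fun h => hca (hbc h)⟩, ⟨fun h => hbc (hab h), hca⟩⟩
end
end

section
/- Let ψ : X → Y be a function between two finite metric spaces such that the image ψ(X) is D-dense in Y for some D ≥ 0 (every point of Y is within distance D of some point of ψ(X)). Let B ⊆ Y be nonempty. Then |ψ⁻¹(B)| ≥ |B| · (1/N_Y(D)) · (1 − |∂ᶦⁿ_D(B)|/|B|), where N_Y(D) = sup_{y ∈ Y} |B(y, D)| and ∂ᶦⁿ_D(B) = {y ∈ B : d(y, Y ∖ B) ≤ D} is the inner D-boundary of B. -/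
noncomputable section

namespace QLF

variable {X Y : Type*}

/-- `N_Y(D) = sup_{y ∈ Y} |B(y,D)|`: the maximal cardinality of a closed `D`-ball in the
finite metric space `Y`. -/
def ballCardSup (Y : Type*) [MetricSpace Y] [Fintype Y] (D : ℝ) : ℕ :=
  letI := Classical.propDecidable
  Finset.univ.sup fun y : Y => (Finset.univ.filter fun z : Y => dist z y ≤ D).card

/-- The outer `S`-boundary `∂_S A = {x ∉ A : d(x,A) ≤ S}` of a subset of a finite metric
space. -/
def outB [MetricSpace Y] [Fintype Y] (A : Finset Y) (S : ℝ) : Finset Y :=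
  letI := Classical.propDecidable
  Finset.univ.filter fun x => x ∉ A ∧ ∃ a ∈ A, dist x a ≤ S

/-- The inner `D`-boundary `∂ᶦⁿ_D B = {y ∈ B : d(y, Y∖B) ≤ D}` of a subset of a finite
metric space. -/
def innB [MetricSpace Y] [Fintype Y] (B : Finset Y) (D : ℝ) : Finset Y :=
  letI := Classical.propDecidable
  B.filter fun y => ∃ z : Y, z ∉ B ∧ dist y z ≤ D

/-- The preimage `ψ⁻¹(B)` as a finset. -/
def preim [Fintype X] (ψ : X → Y) (B : Finset Y) : Finset X :=
  letI := Classical.propDecidable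
  Finset.univ.filter fun x => ψ x ∈ B

end QLF

namespace QLF

open Classical in
/-- Every `D`-ball has at most `ballCardSup Y D` points. -/
theorem card_ball_le_ballCardSup {Y : Type*} [MetricSpace Y] [Fintype Y] (D : ℝ) (y : Y) :
    (Finset.univ.filter fun z : Y => dist z y ≤ D).card ≤ ballCardSup Y D := by
  unfold ballCardSup
  convert Finset.le_sup (f := fun y : Y => (Finset.univ.filter fun z : Y => dist z y ≤ D).card)
    (Finset.mem_univ y)

open Classical in
/-- If `ψ` has `D`-dense image, the `D`-balls around the points of `ψ(X) ∩ B` cover `B` up to its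
inner `D`-boundary. -/
theorem card_le_card_preim_mul_add_card_innB {X Y : Type*} [MetricSpace Y] [Fintype X] [Fintype Y]
    (ψ : X → Y) (D : ℝ) (hdense : ∀ y : Y, ∃ x : X, dist (ψ x) y ≤ D) (B : Finset Y) :
    B.card ≤ (preim ψ B).card * ballCardSup Y D + (innB B D).card := by
  have hcover : B ⊆ ((preim ψ B).biUnion fun x =>
      Finset.univ.filter fun z : Y => dist z (ψ x) ≤ D) ∪ innB B D := by
    intro y hy
    obtain ⟨x, hx⟩ := hdense y
    rw [dist_comm] at hx
    by_cases hxB : ψ x ∈ B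
    · refine Finset.mem_union_left _ (Finset.mem_biUnion.2 ⟨x, ?_, ?_⟩)
      · simpa [preim] using hxB
      · simpa using hx
    · refine Finset.mem_union_right _ ?_
      simpa [innB] using ⟨hy, ψ x, hxB, hx⟩
  calc B.card ≤ _ := Finset.card_le_card hcover
    _ ≤ _ := Finset.card_union_le _ _
    _ ≤ _ := Nat.add_le_add_right
      (Finset.card_biUnion_le_card_mul _ _ _ fun x _ => card_ball_le_ballCardSup D (ψ x)) _

end QLF

open QLF in
/-- **Lemma 3.11.** If `ψ : X → Y` is a map between finite metric spaces whose
image is `D`-dense in `Y` and `B ⊆ Y` is nonempty, then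
`|ψ⁻¹(B)| ≥ |B| · (1/N_Y(D)) · (1 − |∂ᶦⁿ_D(B)|/|B|)`. -/
theorem card_preimage_ge {X Y : Type*} [MetricSpace X] [MetricSpace Y]
    [Fintype X] [Fintype Y] (ψ : X → Y) (D : ℝ) (hD : 0 ≤ D)
    (hdense : ∀ y : Y, ∃ x : X, dist (ψ x) y ≤ D)
    (B : Finset Y) (hB : B.Nonempty) :
    ((preim ψ B).card : ℝ)
      ≥ (B.card : ℝ) * (1 / (ballCardSup Y D : ℝ))
          * (1 - ((innB B D).card : ℝ) / (B.card : ℝ)) := by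
  have hBpos : (0 : ℝ) < B.card := by exact_mod_cast hB.card_pos
  have hcard : (B.card : ℝ) ≤ (preim ψ B).card * ballCardSup Y D + (innB B D).card := by
    exact_mod_cast card_le_card_preim_mul_add_card_innB ψ D hdense B
  have hrewrite : (B.card : ℝ) * (1 / (ballCardSup Y D : ℝ))
      * (1 - ((innB B D).card : ℝ) / (B.card : ℝ))
      = ((B.card : ℝ) - (innB B D).card) / ballCardSup Y D := by
    field_simp
  rw [ge_iff_le, hrewrite]
  exact div_le_of_le_mul₀ (Nat.cast_nonneg _) (Nat.cast_nonneg _) (by linarith)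
end
end

section
/- Let {X_n} and {Y_n} be sequences of finite nonempty metric spaces with |X_n| → ∞ and |Y_n| → ∞ as n → ∞, such that some coarse disjoint unions X = ⊔_n X_n and Y = ⊔_n Y_n have bounded geometry. For each n let φ_n : X_n → Y_n be a function, and assume the combined map φ = ⊔_n φ_n : X → Y is a coarse equivalence, i.e., there exist non-decreasing functions ρ₋, ρ₊ : ℝ₊ → ℝ₊ with ρ₋(t) → ∞ as t → ∞ such that ρ₋(d(x,y)) ≤ d(φ(x), φ(y)) ≤ ρ₊(d(x,y)) for all x, y ∈ X, and there exists D ≥ 0 such that φ(X) is D-dense in Y. If {X_n} is a sequence of asymptotic expanders, then so is {Y_n}. -/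
noncomputable section

namespace QL

variable {X : Type*}

/-- `X` has bounded geometry: closed balls of each fixed radius have uniformly bounded
(finite) cardinality. -/
def BoundedGeometry (X : Type*) [MetricSpace X] : Prop :=
  ∀ R : ℝ, 0 < R → ∃ C : ℕ, ∀ x : X,
    (Metric.closedBall x R).Finite ∧ (Metric.closedBall x R).ncard ≤ C

/-- `X` is a coarse disjoint union of the sequence of pieces `Xn`: the pieces partition `X`,
are nonempty, and `d(Xn, Xm) → ∞` as `n + m → ∞` with `n ≠ m` (each piece carries the
restriction of the metric of `X`). -/
def IsCoarseDisjointUnion [MetricSpace X] (Xn : ℕ → Finset X) : Prop :=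
  (∀ x : X, ∃! n : ℕ, x ∈ Xn n) ∧
  (∀ n : ℕ, (Xn n).Nonempty) ∧
  (∀ K : ℝ, ∃ N : ℕ, ∀ m n : ℕ, m ≠ n → N ≤ m + n →
    ∀ x ∈ Xn m, ∀ y ∈ Xn n, K ≤ dist x y)

/-- The outer `R`-boundary of `A` taken inside the subspace `Xn`:
`{x ∈ Xn \ A : d(x, A) ≤ R}`. -/
def outBdry [MetricSpace X] (Xn A : Finset X) (R : ℝ) : Finset X :=
  letI := Classical.propDecidable
  Xn.filter fun x => x ∉ A ∧ ∃ a ∈ A, dist x a ≤ R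

/-- A sequence of pieces `Xn` (each carrying the restriction of the ambient metric) is a
sequence of asymptotic expanders: for every `α > 0` there are `c ∈ (0,1)` and `R > 0` such
that every `A ⊆ Xn` with `α|Xn| ≤ |A| ≤ |Xn|/2` satisfies `|∂_R A| > c|A|`,
boundaries being taken inside `Xn`. -/
def IsAsymptoticExpanderSeq [MetricSpace X] (Xn : ℕ → Finset X) : Prop :=
  ∀ α : ℝ, 0 < α → ∃ c ∈ Set.Ioo (0 : ℝ) 1, ∃ R : ℝ, 0 < R ∧
    ∀ n : ℕ, ∀ A : Finset X, A ⊆ Xn n →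
      α * ((Xn n).card : ℝ) ≤ (A.card : ℝ) → (A.card : ℝ) ≤ ((Xn n).card : ℝ) / 2 →
      c * (A.card : ℝ) < ((outBdry (Xn n) A R).card : ℝ)

end QL

namespace QL

open Filter

theorem BoundedGeometry.exists_pos {X : Type*} [MetricSpace X] (h : BoundedGeometry X) (R : ℝ) :
    ∃ C : ℕ, 0 < C ∧ ∀ (x : X) (S : Finset X), (∀ s ∈ S, dist s x ≤ R) → S.card ≤ C := by
  obtain ⟨C, hC⟩ := h (max R 1) (by positivity)
  refine ⟨C + 1, C.succ_pos, fun x S hS => ?_⟩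
  have hsub : (S : Set X) ⊆ Metric.closedBall x (max R 1) :=
    fun s hs => (hS s hs).trans (le_max_left _ _)
  have hcard := Set.ncard_le_ncard hsub (hC x).1
  rw [Set.ncard_coe_finset] at hcard
  exact (hcard.trans (hC x).2).trans C.le_succ

theorem card_le_mul_card_of_dist_le {X : Type*} [MetricSpace X] {R : ℝ} {C : ℕ}
    (hC : ∀ (x : X) (S : Finset X), (∀ s ∈ S, dist s x ≤ R) → S.card ≤ C)
    (S T : Finset X) (h : ∀ s ∈ S, ∃ t ∈ T, dist s t ≤ R) : S.card ≤ C * T.card := by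
  classical
  have hsub : S ⊆ T.biUnion fun t => S.filter fun s => dist s t ≤ R := by
    intro s hs
    obtain ⟨t, ht, hst⟩ := h s hs
    exact Finset.mem_biUnion.2 ⟨t, ht, Finset.mem_filter.2 ⟨hs, hst⟩⟩
  refine (Finset.card_le_card hsub).trans ?_
  rw [mul_comm]
  exact Finset.card_biUnion_le_card_mul _ _ _ fun t _ =>
    hC t _ fun s hs => (Finset.mem_filter.1 hs).2

theorem card_le_mul_card_of_mapsTo {X Y : Type*} [MetricSpace X] {R : ℝ} {C : ℕ}
    (hC : ∀ (x : X) (S : Finset X), (∀ s ∈ S, dist s x ≤ R) → S.card ≤ C)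
    (f : X → Y) (hf : ∀ x y, f x = f y → dist x y ≤ R)
    (S : Finset X) (T : Finset Y) (h : ∀ s ∈ S, f s ∈ T) : S.card ≤ C * T.card := by
  classical
  refine Finset.card_le_mul_card_image_of_maps_to h C fun y _ => ?_
  obtain hS | ⟨x, hx⟩ := (S.filter fun s => f s = y).eq_empty_or_nonempty
  · simp [hS]
  · refine hC x _ fun s hs => hf s x ?_
    rw [(Finset.mem_filter.1 hs).2, (Finset.mem_filter.1 hx).2]

theorem mem_outBdry {X : Type*} [MetricSpace X] {Xn A : Finset X} {R : ℝ} {x : X} :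
    x ∈ outBdry Xn A R ↔ x ∈ Xn ∧ x ∉ A ∧ ∃ a ∈ A, dist x a ≤ R := by
  simp [outBdry]

/-- A map between coarse disjoint unions that respects the pieces and has dense image has
uniformly dense image in each piece. -/
theorem exists_dense_pieces {X Y : Type*} [MetricSpace X] [MetricSpace Y]
    {Xn : ℕ → Finset X} {Yn : ℕ → Finset Y}
    (hX : IsCoarseDisjointUnion Xn) (hY : IsCoarseDisjointUnion Yn)
    {φ : X → Y} (hφ : ∀ n : ℕ, ∀ x ∈ Xn n, φ x ∈ Yn n)
    {D : ℝ} (hD : 0 ≤ D) (hdense : ∀ y : Y, ∃ x : X, dist (φ x) y ≤ D) :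
    ∃ E : ℝ, 0 ≤ E ∧ ∀ n, ∀ y ∈ Yn n, ∃ x ∈ Xn n, dist y (φ x) ≤ E := by
  classical
  obtain ⟨N, hN⟩ := hY.2.2 (D + 1)
  have hbdd : Bornology.IsBounded (((Finset.range N).biUnion Yn : Finset Y) : Set Y) :=
    (Finset.finite_toSet _).isBounded
  obtain ⟨M, hM⟩ := Metric.isBounded_iff.1 hbdd
  refine ⟨max D M, hD.trans (le_max_left _ _), fun n y hy => ?_⟩
  by_cases hn : n < N
  · obtain ⟨x, hx⟩ := hX.2.1 n
    have hmem : ∀ z ∈ Yn n, z ∈ (((Finset.range N).biUnion Yn : Finset Y) : Set Y) :=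
      fun z hz => Finset.mem_coe.2 (Finset.mem_biUnion.2 ⟨n, Finset.mem_range.2 hn, hz⟩)
    exact ⟨x, hx, (hM (hmem y hy) (hmem _ (hφ n x hx))).trans (le_max_right _ _)⟩
  · obtain ⟨x, hx⟩ := hdense y
    obtain ⟨m, hm, -⟩ := hX.1 x
    obtain rfl : m = n := by
      by_contra hmn
      have := hN m n hmn (by omega) _ (hφ m x hm) y hy
      linarith
    exact ⟨x, hm, by rw [dist_comm]; exact hx.trans (le_max_left _ _)⟩

end QL

open QL Filter in
/-- **Theorem 3.10.** Let `X` and `Y` be bounded geometry coarse disjoint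
unions of sequences of finite nonempty metric spaces `Xn`, `Yn` with `|Xn|, |Yn| → ∞`, and
let `φ : X → Y` be a coarse equivalence mapping each piece `Xn` into the corresponding
piece `Yn`.  If `{Xn}` is a sequence of asymptotic expanders, then so is `{Yn}`. -/
theorem asymptoticExpander_of_coarseEquiv_pieces {X Y : Type*}
    [MetricSpace X] [MetricSpace Y]
    (Xn : ℕ → Finset X) (Yn : ℕ → Finset Y)
    (hXcdu : IsCoarseDisjointUnion Xn) (hYcdu : IsCoarseDisjointUnion Yn)
    (hXgrow : Tendsto (fun n => (Xn n).card) atTop atTop)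
    (hYgrow : Tendsto (fun n => (Yn n).card) atTop atTop)
    (hXbg : BoundedGeometry X) (hYbg : BoundedGeometry Y)
    (φ : X → Y) (hφpieces : ∀ n : ℕ, ∀ x ∈ Xn n, φ x ∈ Yn n)
    (ρminus ρplus : ℝ → ℝ) (hm₁ : Monotone ρminus) (hm₂ : Monotone ρplus)
    (hρinf : Tendsto ρminus atTop atTop)
    (hρ : ∀ x y : X, ρminus (dist x y) ≤ dist (φ x) (φ y) ∧
      dist (φ x) (φ y) ≤ ρplus (dist x y))
    (D : ℝ) (hD : 0 ≤ D) (hdense : ∀ y : Y, ∃ x : X, dist (φ x) y ≤ D)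
    (hexp : IsAsymptoticExpanderSeq Xn) :
    IsAsymptoticExpanderSeq Yn := by
  classical
  obtain ⟨E, hE, hdn⟩ := exists_dense_pieces hXcdu hYcdu hφpieces hD hdense
  obtain ⟨C, hC0, hC⟩ := hYbg.exists_pos E
  obtain ⟨T, hT⟩ : ∃ T : ℝ, ∀ x y, φ x = φ y → dist x y ≤ T := by
    obtain ⟨T, hT⟩ := (hρinf.eventually_gt_atTop 0).exists
    refine ⟨T, fun x y hxy => ?_⟩
    by_contra! hlt
    have h₁ := (hρ x y).1
    rw [hxy, dist_self] at h₁
    linarith [hm₁ hlt.le]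
  obtain ⟨K, hK0, hK⟩ := hXbg.exists_pos T
  intro α hα
  have hC1 : (1 : ℝ) ≤ C := by exact_mod_cast hC0
  have hK1 : (1 : ℝ) ≤ K := by exact_mod_cast hK0
  obtain ⟨c, ⟨hc0, hc1⟩, r, hr, hX⟩ := hexp (α / (2 * C * K)) (by positivity)
  obtain ⟨L, hL0, hL⟩ := hXbg.exists_pos r
  have hL1 : (1 : ℝ) ≤ L := by exact_mod_cast hL0
  have hCKL : (1 : ℝ) ≤ C * K * L := one_le_mul_of_one_le_of_one_le
    (one_le_mul_of_one_le_of_one_le hC1 hK1) hL1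
  have hchalf : c / (2 * (C * K * L)) ≤ 1 / 2 := by
    rw [div_le_div_iff₀ (by positivity) (by norm_num)]
    linarith
  set R := max (max (2 * E) (ρplus r + E)) 1 with hR
  have hR₁ : 2 * E ≤ R := (le_max_left _ _).trans (le_max_left _ _)
  have hR₂ : ρplus r + E ≤ R := (le_max_right _ _).trans (le_max_left _ _)
  refine ⟨c / (2 * (C * K * L)), ⟨by positivity, by linarith⟩, R, by positivity, ?_⟩
  intro n A hA hαA hA2
  by_contra! hbd
  have hxy : ((Xn n).card : ℝ) ≤ K * (Yn n).card := by
    exact_mod_cast card_le_mul_card_of_mapsTo hK φ hT _ _ (hφpieces n)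
  -- A subset of `Xn n` of comparable size has large boundary.
  have key : ∀ S ⊆ Xn n, (A.card : ℝ) ≤ 2 * C * S.card →
      (S.card : ℝ) ≤ ((Xn n).card : ℝ) / 2 →
      ¬ (outBdry (Xn n) S r).card ≤ L * (K * (outBdry (Yn n) A R).card) := by
    intro S hS hAS hS2 hle
    have hle' : ((outBdry (Xn n) S r).card : ℝ) ≤ L * (K * (outBdry (Yn n) A R).card) := by
      exact_mod_cast hle
    have hlow : α / (2 * C * K) * ((Xn n).card : ℝ) ≤ S.card := by
      calc α / (2 * C * K) * ((Xn n).card : ℝ)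
          ≤ α / (2 * C * K) * (K * (Yn n).card) := by gcongr
        _ = (α * (Yn n).card) / (2 * C) := by field_simp
        _ ≤ (2 * C * S.card) / (2 * C) :=
          div_le_div_of_nonneg_right (hαA.trans hAS) (by positivity)
        _ = S.card := by field_simp
    have hlt := hX n S hS hlow hS2
    have : (L * (K * (outBdry (Yn n) A R).card) : ℝ) ≤ c * S.card := by
      calc (L * (K * (outBdry (Yn n) A R).card) : ℝ)
          ≤ L * (K * (c / (2 * (C * K * L)) * (2 * C * S.card))) := by
            gcongr
            exact hbd.trans (by gcongr)
        _ = c * S.card := by field_simp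
    linarith
  -- The preimage of the `E`-neighbourhood of `A`, and its complement.
  let B := (Xn n).filter fun x => ∃ a ∈ A, dist (φ x) a ≤ E
  let B' := (Xn n).filter fun x => ¬ ∃ a ∈ A, dist (φ x) a ≤ E
  have hBB' : (B.card : ℝ) + B'.card = (Xn n).card := by
    exact_mod_cast Finset.card_filter_add_card_filter_not (s := Xn n)
      (fun x => ∃ a ∈ A, dist (φ x) a ≤ E)
  have hAB : (A.card : ℝ) ≤ C * B.card := by
    have h₁ : A.card ≤ C * (B.image φ).card := by
      refine card_le_mul_card_of_dist_le hC _ _ fun a ha => ?_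
      obtain ⟨x, hx, hxa⟩ := hdn n a (hA ha)
      exact ⟨φ x, Finset.mem_image_of_mem _ (Finset.mem_filter.2
        ⟨hx, a, ha, by rwa [dist_comm]⟩), hxa⟩
    exact_mod_cast h₁.trans (Nat.mul_le_mul_left _ Finset.card_image_le)
  have hAB' : (A.card : ℝ) ≤ 2 * C * B'.card := by
    have h₁ : (Yn n \ (A ∪ outBdry (Yn n) A R)).card ≤ C * (B'.image φ).card := by
      refine card_le_mul_card_of_dist_le hC _ _ fun y hy => ?_
      simp only [Finset.mem_sdiff, Finset.mem_union, mem_outBdry] at hy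
      obtain ⟨hy, hyA⟩ := hy
      obtain ⟨x, hx, hxy⟩ := hdn n y hy
      refine ⟨φ x, Finset.mem_image_of_mem _ (Finset.mem_filter.2 ⟨hx, ?_⟩), hxy⟩
      rintro ⟨a, ha, hxa⟩
      refine hyA (or_iff_not_imp_left.2 fun hyA' => ⟨hy, hyA', a, ha, ?_⟩)
      linarith [dist_triangle y (φ x) a]
    have h₂ : ((Yn n).card : ℝ) ≤ A.card + (outBdry (Yn n) A R).card + C * B'.card := by
      have h₃ := Finset.card_le_card_sdiff_add_card (s := Yn n) (t := A ∪ outBdry (Yn n) A R)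
      have h₄ := Finset.card_union_le A (outBdry (Yn n) A R)
      have h₅ := h₁.trans (Nat.mul_le_mul_left _ Finset.card_image_le)
      exact_mod_cast (by omega : (Yn n).card ≤ A.card + (outBdry (Yn n) A R).card + C * B'.card)
    have h₃ : c / (2 * (C * K * L)) * (A.card : ℝ) ≤ 1 / 2 * A.card := by gcongr
    linarith
  have hcross : ∀ x ∈ B', ∀ b ∈ B, dist x b ≤ r → φ x ∈ outBdry (Yn n) A R := by
    intro x hx b hb hxb
    obtain ⟨hx, hxA⟩ := Finset.mem_filter.1 hx
    obtain ⟨hb, a, ha, hba⟩ := Finset.mem_filter.1 hb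
    refine mem_outBdry.2 ⟨hφpieces n x hx, fun h => hxA ⟨φ x, h, by simpa using hE⟩, a, ha, ?_⟩
    linarith [dist_triangle (φ x) (φ b) a, (hρ x b).2, hm₂ hxb]
  have hpre : ((Xn n).filter fun x => φ x ∈ outBdry (Yn n) A R).card
      ≤ K * (outBdry (Yn n) A R).card :=
    card_le_mul_card_of_mapsTo hK φ hT _ _ fun x hx => (Finset.mem_filter.1 hx).2
  have hnear : ∀ S : Finset X, (∀ s ∈ S, ∃ x ∈ Xn n, φ x ∈ outBdry (Yn n) A R ∧ dist s x ≤ r) →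
      S.card ≤ L * (K * (outBdry (Yn n) A R).card) := by
    intro S hS
    refine (card_le_mul_card_of_dist_le hL S _ fun s hs => ?_).trans (Nat.mul_le_mul_left _ hpre)
    obtain ⟨x, hx, hφx, hsx⟩ := hS s hs
    exact ⟨x, Finset.mem_filter.2 ⟨hx, hφx⟩, hsx⟩
  rcases le_total (B.card : ℝ) B'.card with hle | hle
  · refine key B (Finset.filter_subset _ _) ?_ (by linarith) (hnear _ fun x hx => ?_)
    · linarith [(by positivity : (0 : ℝ) ≤ C * B.card)]
    · obtain ⟨hx, hxB, b, hb, hxb⟩ := mem_outBdry.1 hx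
      have hxB' : x ∈ B' := Finset.mem_filter.2 ⟨hx, fun h => hxB (Finset.mem_filter.2 ⟨hx, h⟩)⟩
      exact ⟨x, hx, hcross x hxB' b hb hxb, by simpa using hr.le⟩
  · refine key B' (Finset.filter_subset _ _) hAB' (by linarith) (hnear _ fun x hx => ?_)
    obtain ⟨hx, hxB', b, hb, hxb⟩ := mem_outBdry.1 hx
    have hxB : x ∈ B := Finset.mem_filter.2
      ⟨hx, not_not.1 fun h => hxB' (Finset.mem_filter.2 ⟨hx, h⟩)⟩
    exact ⟨b, (Finset.mem_filter.1 hb).1, hcross b hb x hxB (by rwa [dist_comm]), hxb⟩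
end
end

section
/- Let (X, d) be a metric space with bounded geometry. Then the following are equivalent: (1) for all R, ε > 0 there exist a map ξ : X → ℓ²(X) and a number S > 0 such that ‖ξ_x‖ = 1 for every x ∈ X, ‖ξ_x − ξ_y‖ < ε whenever d(x,y) < R, and supp(ξ_x) ⊆ B(x, S) for every x ∈ X; (2) for all R, ε > 0 there exists a map η : X → ℓ²(X) such that ‖η_x‖ = 1 for every x ∈ X, ‖η_x − η_y‖ < ε whenever d(x,y) < R, and lim_{S → ∞} sup_{x ∈ X} Σ_{z ∉ B(x,S)} |η_x(z)|² = 0. -/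
noncomputable section

abbrev L2 (X : Type*) : Type _ := lp (fun _ : X => ℂ) 2

/-- Normalising a small perturbation `g` of a unit vector `f` at most doubles the error. -/
theorem norm_sub_inv_norm_smul_le {E : Type*} [NormedAddCommGroup E] [NormedSpace ℂ E]
    {f g : E} {δ : ℝ} (hf : ‖f‖ = 1) (hg : g ≠ 0) (hfg : ‖f - g‖ ≤ δ) :
    ‖f - ((‖g‖ : ℂ)⁻¹) • g‖ ≤ 2 * δ := by
  have hg' : ‖g‖ ≠ 0 := norm_ne_zero_iff.2 hg
  have hc : (‖g‖ : ℂ) ≠ 0 := by exact_mod_cast hg'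
  have h1 : g - ((‖g‖ : ℂ)⁻¹) • g = (((‖g‖ - 1 : ℝ) : ℂ) * (‖g‖ : ℂ)⁻¹) • g := by
    push_cast
    rw [sub_mul, mul_inv_cancel₀ hc, sub_smul, one_smul, one_mul]
  have h2 : ‖g - ((‖g‖ : ℂ)⁻¹) • g‖ ≤ ‖f - g‖ := by
    rw [h1, norm_smul, norm_mul, norm_inv, Complex.norm_real, Complex.norm_real, norm_norm,
      mul_assoc, inv_mul_cancel₀ hg', mul_one, Real.norm_eq_abs, abs_sub_comm, ← hf]
    exact abs_norm_sub_norm_le f g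
  calc ‖f - ((‖g‖ : ℂ)⁻¹) • g‖ ≤ ‖f - g‖ + ‖g - ((‖g‖ : ℂ)⁻¹) • g‖ :=
        norm_sub_le_norm_sub_add_norm_sub _ _ _
    _ ≤ 2 * δ := by linarith

theorem L2.summable_norm_sq {X : Type*} (f : L2 X) : Summable fun z => ‖f z‖ ^ 2 := by
  simpa using (lp.memℓp f).summable (p := 2) (by norm_num)

theorem L2.norm_sq_eq_tsum {X : Type*} (f : L2 X) : ‖f‖ ^ 2 = ∑' z, ‖f z‖ ^ 2 := by
  simpa using lp.norm_rpow_eq_tsum (p := 2) (by norm_num) f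

/-- The restriction of a square-summable function to a set, extended by zero. -/
theorem L2.exists_restrict {X : Type*} (f : L2 X) (p : X → Prop) [DecidablePred p] :
    ∃ g : L2 X, ∀ z, g z = if p z then f z else 0 := by
  refine ⟨⟨fun z => if p z then f z else 0, memℓp_gen ?_⟩, fun z => rfl⟩
  refine Summable.of_nonneg_of_le (fun z => by positivity) (fun z => ?_)
    ((lp.memℓp f).summable (p := 2) (by norm_num))
  split_ifs <;> simp

open QL Filter in
/-- **Lemma 5.4.** For a bounded geometry metric space `X`, the standard
"Property A" condition with uniformly supported vectors (1) is equivalent to the variant (2)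
where the support condition is replaced by uniform summability at infinity:
`lim_{S→∞} sup_x Σ_{z ∉ B(x,S)} |η_x(z)|² = 0`. -/
theorem propertyA_iff_strong_summability {X : Type*} [MetricSpace X]
    (hbg : BoundedGeometry X) :
    (∀ R : ℝ, 0 < R → ∀ ε : ℝ, 0 < ε → ∃ (ξ : X → L2 X) (S : ℝ), 0 < S ∧
        (∀ x : X, ‖ξ x‖ = 1) ∧
        (∀ x y : X, dist x y < R → ‖ξ x - ξ y‖ < ε) ∧
        (∀ x z : X, (ξ x) z ≠ 0 → dist z x ≤ S)) ↔
    (∀ R : ℝ, 0 < R → ∀ ε : ℝ, 0 < ε → ∃ η : X → L2 X,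
        (∀ x : X, ‖η x‖ = 1) ∧
        (∀ x y : X, dist x y < R → ‖η x - η y‖ < ε) ∧
        Tendsto (fun S : ℝ => ⨆ x : X,
            ∑' z : X, if dist z x ≤ S then 0 else ‖(η x) z‖ ^ 2)
          atTop (nhds 0)) := by
  constructor
  · intro h R hR ε hε
    obtain ⟨ξ, S, -, h1, h2, h3⟩ := h R hR ε hε
    refine ⟨ξ, h1, h2, tendsto_const_nhds.congr' ?_⟩
    filter_upwards [eventually_ge_atTop S] with T hT
    have h0 : ∀ x z : X, (if dist z x ≤ T then (0 : ℝ) else ‖(ξ x) z‖ ^ 2) = 0 := by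
      intro x z
      split_ifs with hz
      · rfl
      · have : (ξ x) z = 0 := by
          by_contra hne
          exact hz ((h3 x z hne).trans hT)
        simp [this]
    simp [h0]
  · intro h R hR ε hε
    obtain ⟨η, h1, h2, h3⟩ := h R hR (ε / 2) (half_pos hε)
    obtain ⟨δ, hδ, hδ1, hδε⟩ : ∃ δ : ℝ, 0 < δ ∧ δ < 1 ∧ 8 * δ ≤ ε :=
      ⟨min (1 / 2) (ε / 8), by positivity, (min_le_left _ _).trans_lt (by norm_num),
        by linarith [min_le_right (1 / 2) (ε / 8)]⟩
    obtain ⟨S, hS, hS0⟩ :=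
      ((h3.eventually (gt_mem_nhds (pow_pos hδ 2))).and (eventually_gt_atTop 0)).exists
    have htail : ∀ x, ∑' z : X, (if dist z x ≤ S then 0 else ‖(η x) z‖ ^ 2) ≤ δ ^ 2 := by
      refine fun x => (le_ciSup (f := fun x : X =>
        ∑' z : X, if dist z x ≤ S then 0 else ‖(η x) z‖ ^ 2) ⟨1, ?_⟩ x).trans hS.le
      rintro _ ⟨y, rfl⟩
      have hle : ∀ z, (if dist z y ≤ S then 0 else ‖(η y) z‖ ^ 2) ≤ ‖(η y) z‖ ^ 2 := by
        intro z
        split_ifs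
        · positivity
        · rfl
      calc _ ≤ ∑' z, ‖(η y) z‖ ^ 2 :=
            Summable.tsum_le_tsum hle (Summable.of_nonneg_of_le
              (fun z => by positivity) hle (L2.summable_norm_sq _)) (L2.summable_norm_sq _)
        _ = 1 := by rw [← L2.norm_sq_eq_tsum, h1, one_pow]
    choose g hg using fun x => L2.exists_restrict (η x) (fun z => dist z x ≤ S)
    have hηg : ∀ x, ‖η x - g x‖ ≤ δ := by
      refine fun x => le_of_sq_le_sq ?_ hδ.le
      rw [L2.norm_sq_eq_tsum]
      refine le_of_eq_of_le (tsum_congr fun z => ?_) (htail x)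
      rw [lp.coeFn_sub, Pi.sub_apply, hg]
      split_ifs <;> simp
    have hg0 : ∀ x, g x ≠ 0 := by
      intro x hx
      have := hηg x
      rw [hx, sub_zero, h1] at this
      linarith
    refine ⟨fun x => ((‖g x‖ : ℂ)⁻¹) • g x, S, hS0, fun x => ?_, fun x y hxy => ?_,
      fun x z hz => ?_⟩
    · rw [norm_smul, norm_inv, Complex.norm_real, norm_norm,
        inv_mul_cancel₀ (norm_ne_zero_iff.2 (hg0 x))]
    · have hx := norm_sub_inv_norm_smul_le (h1 x) (hg0 x) (hηg x)
      have hy := norm_sub_inv_norm_smul_le (h1 y) (hg0 y) (hηg y)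
      rw [norm_sub_rev] at hx
      have hxy' := h2 x y hxy
      have ha := norm_sub_le_norm_sub_add_norm_sub (((‖g x‖ : ℂ)⁻¹) • g x) (η x)
        (((‖g y‖ : ℂ)⁻¹) • g y)
      have hb := norm_sub_le_norm_sub_add_norm_sub (η x) (η y) (((‖g y‖ : ℂ)⁻¹) • g y)
      linarith
    · by_contra hne
      apply hz
      rw [lp.coeFn_smul, Pi.smul_apply, hg, if_neg hne, smul_zero]
end
end
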